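/- Let Λ be the set of vectors in the Euclidean plane ℝ² of the form m·(1,0) + n·(1/2, √3/2) with m, n ∈ ℤ (the unit triangular lattice). Then there do not exist v, w ∈ Λ with v ≠ 0 and ‖w‖² = 2·‖v‖²; that is, a scale factor of √2 is not possible between nonzero distances realized by Λ. -/

import Mathlib

noncomputable section

/-- The Euclidean plane. -/
abbrev Plane : Type := EuclideanSpace ℝ (Fin 2)

/-- The vector `(1, 0)` in the plane. -/
def e₁ : Plane := (WithLp.equiv 2 (Fin 2 → ℝ)).symm ![1, 0]

/-- The vector `(1/2, √3/2)` in the plane. -/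
def e₂ : Plane := (WithLp.equiv 2 (Fin 2 → ℝ)).symm ![1 / 2, Real.sqrt 3 / 2]

/-- The unit triangular lattice: integer combinations of `(1,0)` and `(1/2, √3/2)`. -/
def triLattice : Set Plane := {v : Plane | ∃ m n : ℤ, v = (m : ℝ) • e₁ + (n : ℝ) • e₂}

theorem norm_sq_smul_e₁_add_smul_e₂ (a b : ℝ) :
    ‖a • e₁ + b • e₂‖ ^ 2 = a ^ 2 + a * b + b ^ 2 := by
  have h3 : Real.sqrt 3 ^ 2 = 3 := Real.sq_sqrt (by norm_num)
  rw [EuclideanSpace.norm_sq_eq]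
  simp only [e₁, e₂, Fin.sum_univ_two, Real.norm_eq_abs, sq_abs]
  simp
  linear_combination b ^ 2 / 4 * h3

theorem even_and_even_of_even_sq_add_mul_add_sq {p q : ℤ}
    (h : Even (p ^ 2 + p * q + q ^ 2)) : Even p ∧ Even q := by
  simp only [Int.even_add, Int.even_mul, Int.even_pow' two_ne_zero] at h
  tauto

theorem sq_add_mul_add_sq_eq_zero_of_eq_two_mul (m n p q : ℤ)
    (h : p ^ 2 + p * q + q ^ 2 = 2 * (m ^ 2 + m * n + n ^ 2)) :
    m ^ 2 + m * n + n ^ 2 = 0 := by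
  induction hk : (m ^ 2 + m * n + n ^ 2).toNat using Nat.strong_induction_on
    generalizing m n p q with
  | _ k ih =>
    obtain ⟨⟨r, rfl⟩, ⟨s, rfl⟩⟩ :=
      even_and_even_of_even_sq_add_mul_add_sq (h ▸ even_two_mul _)
    have hrs : m ^ 2 + m * n + n ^ 2 = 2 * (r ^ 2 + r * s + s ^ 2) := by linarith
    have hnonneg : 0 ≤ r ^ 2 + r * s + s ^ 2 := by
      nlinarith [sq_nonneg (r + s), sq_nonneg r, sq_nonneg s]
    by_contra hne
    have hzero := ih _ (by omega) r s m n hrs rfl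
    omega

/-- A scale factor of `√2` is not possible between nonzero distances realized by
the unit triangular lattice. -/
theorem no_sqrt_two_scale_in_triangular_lattice :
    ¬ ∃ v ∈ triLattice, ∃ w ∈ triLattice, v ≠ 0 ∧ ‖w‖ ^ 2 = 2 * ‖v‖ ^ 2 := by
  rintro ⟨v, ⟨m, n, rfl⟩, w, ⟨p, q, rfl⟩, hv, h⟩
  apply hv
  rw [← norm_eq_zero, ← sq_eq_zero_iff]
  rw [norm_sq_smul_e₁_add_smul_e₂] at h ⊢
  rw [norm_sq_smul_e₁_add_smul_e₂] at h
  exact_mod_cast sq_add_mul_add_sq_eq_zero_of_eq_two_mul m n p q (by exact_mod_cast h)
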